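/- arXiv:1612.02330 — 5 statements merged into one kernel-verified Lean document; each statement's English description precedes it below -/
import Mathlib

section
/- Let V be a real vector space, ω : V → ℝ a nonzero linear functional, and F : V → V → ℝ a symmetric bilinear form such that ω(X)·F(X,X) = 0 for every X ∈ V. Then F = 0. -/
/-- If `ω` is a nonzero linear functional on a real vector space `V` and `F` is a
symmetric bilinear form on `V` with `ω X * F X X = 0` for all `X`, then `F = 0`. -/
theorem stmt_0 {V : Type*} [AddCommGroup V] [Module ℝ V]
    (ω : V →ₗ[ℝ] ℝ) (hω : ω ≠ 0)
    (F : V →ₗ[ℝ] V →ₗ[ℝ] ℝ) (hsymm : ∀ X Y : V, F X Y = F Y X)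
    (h : ∀ X : V, ω X * F X X = 0) :
    F = 0 := by
  obtain ⟨A, hA⟩ : ∃ A, ω A ≠ 0 := by
    by_contra! hzero
    exact hω (LinearMap.ext hzero)
  have diag_of_ne (X : V) (hX : ω X ≠ 0) : F X X = 0 :=
    (mul_eq_zero.mp (h X)).resolve_left hX
  have diag (X : V) : F X X = 0 := by
    by_cases hX : ω X = 0
    · have hAA := diag_of_ne A hA
      have hadd := diag_of_ne (A + X) (by simpa [hX] using hA)
      have hsub := diag_of_ne (A - X) (by simpa [hX] using hA)
      simp only [map_add, map_sub, LinearMap.add_apply, LinearMap.sub_apply] at hadd hsub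
      linarith
    · exact diag_of_ne X hX
  ext X Y
  have hadd := diag (X + Y)
  simp only [map_add, LinearMap.add_apply] at hadd
  simp only [LinearMap.zero_apply]
  linarith [diag X, diag Y, hsymm X Y]
end

section
/- Let n ≥ 2 be a natural number, τ, C ∈ ℝ, and let I ⊆ ℝ be an open interval. Suppose f : I → ℝ is twice continuously differentiable with f(t) > 0 for all t ∈ I and satisfies −(n−1)·(f''(t)/f(t) − (f'(t))²/f(t)²) = τ·f(t)^{−2} − C·f(t)² for all t ∈ I. Then there exists a constant A ∈ ℝ such that (f'(t))² = τ/(n−1) + A·f(t)² + (C/(n−1))·f(t)⁴ for all t ∈ I. -/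
/-- First integral of the warped-product ODE (2.4):
`-(n-1)(f''/f - (f')²/f²) = τ f⁻² - C f²` integrates to
`(f')² = τ/(n-1) + A f² + (C/(n-1)) f⁴`. -/
theorem stmt_1 (n : ℕ) (hn : 2 ≤ n) (τ C : ℝ) (I : Set ℝ)
    (hIopen : IsOpen I) (hIconv : Convex ℝ I)
    (f : ℝ → ℝ) (hf : ContDiffOn ℝ 2 f I)
    (hpos : ∀ t ∈ I, 0 < f t)
    (heq : ∀ t ∈ I,
      -((n : ℝ) - 1) * (deriv (deriv f) t / f t - (deriv f t) ^ 2 / (f t) ^ 2)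
        = τ * (f t) ^ (-2 : ℤ) - C * (f t) ^ 2) :
    ∃ A : ℝ, ∀ t ∈ I,
      (deriv f t) ^ 2
        = τ / ((n : ℝ) - 1) + A * (f t) ^ 2 + (C / ((n : ℝ) - 1)) * (f t) ^ 4 := by
  have hm : (n : ℝ) - 1 ≠ 0 := by
    have : (2 : ℝ) ≤ n := by exact_mod_cast hn
    linarith
  set m : ℝ := (n : ℝ) - 1
  have hf' : ∀ t ∈ I, HasDerivAt f (deriv f t) t := fun t ht =>
    ((hf.differentiableOn (by norm_num)).differentiableAt (hIopen.mem_nhds ht)).hasDerivAt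
  have hf'' : ∀ t ∈ I, HasDerivAt (deriv f) (deriv (deriv f) t) t := fun t ht =>
    (((hf.deriv_of_isOpen (m := 1) hIopen (by norm_num)).differentiableOn
      (by norm_num)).differentiableAt (hIopen.mem_nhds ht)).hasDerivAt
  have hode : ∀ t ∈ I,
      deriv (deriv f) t * f t - deriv f t ^ 2 = -(τ / m) + C / m * f t ^ 4 := by
    intro t ht
    have h := heq t ht
    have h0 := (hpos t ht).ne'
    rw [zpow_neg, zpow_ofNat] at h
    field_simp at h ⊢
    linarith
  let E : ℝ → ℝ := fun t => (deriv f t ^ 2 - τ / m - C / m * f t ^ 4) / f t ^ 2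
  have hE : ∀ t ∈ I, HasDerivAt E 0 t := by
    intro t ht
    have h0 := (hpos t ht).ne'
    have h := ((((hf'' t ht).fun_pow 2).sub_const (τ / m)).sub
      (((hf' t ht).fun_pow 4).const_mul (C / m))).div ((hf' t ht).fun_pow 2) (pow_ne_zero 2 h0)
    refine h.congr_deriv (div_eq_zero_iff.2 (Or.inl ?_))
    simp only [Pi.sub_apply]
    push_cast
    linear_combination (2 * f t * deriv f t) * hode t ht
  rcases I.eq_empty_or_nonempty with rfl | ⟨a, ha⟩
  · exact ⟨0, by simp⟩
  refine ⟨E a, fun t ht => ?_⟩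
  have hconst : E a = E t :=
    hIopen.is_const_of_deriv_eq_zero hIconv.isPreconnected
      (fun x hx => (hE x hx).differentiableAt.differentiableWithinAt)
      (fun x hx => (hE x hx).deriv) ha ht
  have h0 := (hpos t ht).ne'
  rw [hconst, div_mul_cancel₀ _ (pow_ne_zero 2 h0)]
  ring
end

section
/- Let 0 < a < 1 and T > 0. Suppose f : [0,T] → ℝ is differentiable, f(0) = 0, 0 ≤ f(t) < a for all t ∈ [0,T], and f'(t) = √((a² − f(t)²)·(a^{−2} − f(t)²)) for all t ∈ [0,T]. Then arcsin(f(T)/a) ≥ T·√(a^{−2} − a²); in particular T ≤ (π/2)/√(a^{−2} − a²). -/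
open Real Set

/-- Along a solution of `f' = √((a² - f²)(b - f²))` with `|f| < a`, the function `arcsin (f / a)`
has derivative `√(b - f²)`. -/
theorem hasDerivWithinAt_arcsin_div_of_sqrt_mul {a b t : ℝ} {f : ℝ → ℝ} {s : Set ℝ}
    (ha : 0 < a) (hlt : |f t| < a)
    (hf : HasDerivWithinAt f (√((a ^ 2 - f t ^ 2) * (b - f t ^ 2))) s t) :
    HasDerivWithinAt (fun x => arcsin (f x / a)) (√(b - f t ^ 2)) s t := by
  obtain ⟨h₁, h₂⟩ := abs_lt.mp hlt
  have hpos : 0 < a ^ 2 - f t ^ 2 := by nlinarith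
  have hsqrt : √(1 - (f t / a) ^ 2) = √(a ^ 2 - f t ^ 2) / a := by
    have hsq : 1 - (f t / a) ^ 2 = (a ^ 2 - f t ^ 2) / a ^ 2 := by field_simp
    rw [hsq, sqrt_div hpos.le, sqrt_sq ha.le]
  have hne₁ : f t / a ≠ -1 := by
    rw [Ne, div_eq_iff ha.ne']
    linarith
  have hne₂ : f t / a ≠ 1 := by
    rw [Ne, div_eq_iff ha.ne']
    linarith
  refine ((hasDerivAt_arcsin hne₁ hne₂).comp_hasDerivWithinAt t (hf.div_const a)).congr_deriv ?_
  have := (sqrt_pos.mpr hpos).ne'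
  rw [hsqrt, sqrt_mul hpos.le]
  field_simp

/-- Estimate for solutions of `f' = √((a² - f²)(a⁻² - f²))` with `0 ≤ f < a < 1`:
`arcsin(f(T)/a) ≥ T √(a⁻² - a²)`, hence `T ≤ (π/2)/√(a⁻² - a²)`. -/
theorem stmt_5 (a T : ℝ) (ha0 : 0 < a) (ha1 : a < 1) (hT : 0 < T)
    (f : ℝ → ℝ)
    (hbound : ∀ t ∈ Icc (0 : ℝ) T, 0 ≤ f t ∧ f t < a)
    (hf0 : f 0 = 0)
    (hderiv : ∀ t ∈ Icc (0 : ℝ) T,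
      HasDerivWithinAt f
        (Real.sqrt ((a ^ 2 - (f t) ^ 2) * ((a⁻¹) ^ 2 - (f t) ^ 2))) (Icc 0 T) t) :
    Real.arcsin (f T / a) ≥ T * Real.sqrt ((a⁻¹) ^ 2 - a ^ 2) ∧
      T ≤ (Real.pi / 2) / Real.sqrt ((a⁻¹) ^ 2 - a ^ 2) := by
  have ha_inv : 1 < a⁻¹ := (one_lt_inv₀ ha0).mpr ha1
  have hc : 0 < √((a⁻¹) ^ 2 - a ^ 2) := sqrt_pos.mpr (by nlinarith)
  have hg : ∀ t ∈ Icc (0 : ℝ) T, HasDerivWithinAt (fun x => arcsin (f x / a))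
      (√((a⁻¹) ^ 2 - f t ^ 2)) (Icc 0 T) t := fun t ht =>
    hasDerivWithinAt_arcsin_div_of_sqrt_mul ha0
      (by rw [abs_of_nonneg (hbound t ht).1]; exact (hbound t ht).2) (hderiv t ht)
  have hg' : ∀ t ∈ interior (Icc (0 : ℝ) T), HasDerivAt (fun x => arcsin (f x / a))
      (√((a⁻¹) ^ 2 - f t ^ 2)) t := fun t ht =>
    (hg t (interior_subset ht)).hasDerivAt (mem_interior_iff_mem_nhds.mp ht)
  have hmain := (convex_Icc (0 : ℝ) T).mul_sub_le_image_sub_of_le_deriv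
    (C := √((a⁻¹) ^ 2 - a ^ 2))
    (fun t ht => (hg t ht).continuousWithinAt)
    (fun t ht => (hg' t ht).differentiableAt.differentiableWithinAt)
    (fun t ht => by
      obtain ⟨h₀, h₁⟩ := hbound t (interior_subset ht)
      rw [(hg' t ht).deriv]
      gcongr)
    0 (left_mem_Icc.mpr hT.le) T (right_mem_Icc.mpr hT.le) hT.le
  have hest : T * √((a⁻¹) ^ 2 - a ^ 2) ≤ arcsin (f T / a) := by
    simpa [hf0, mul_comm] using hmain
  exact ⟨hest, (le_div_iff₀ hc).mpr (hest.trans (arcsin_le_pi_div_two _))⟩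
end

section
/- Let a > 0 and T > 0. Suppose f : [0,T] → ℝ is differentiable, f(0) = 0, 0 ≤ f(t) < a for all t ∈ [0,T], and f'(t) = √((a² − f(t)²)·(a^{−2} + f(t)²)) for all t ∈ [0,T]. Then arcsin(f(T)/a) ≥ T/a; in particular T ≤ a·π/2. -/
open Real Set

/-- Along `f' = √((a² - f²)(a⁻² + f²))` the function `arcsin (f / a)` has derivative
`√(a⁻² + f²)`. -/
theorem hasDerivWithinAt_arcsin_div {a t : ℝ} {f : ℝ → ℝ} {s : Set ℝ} (ha : 0 < a)
    (hlow : -a < f t) (hup : f t < a)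
    (hf : HasDerivWithinAt f
      (Real.sqrt ((a ^ 2 - (f t) ^ 2) * ((a⁻¹) ^ 2 + (f t) ^ 2))) s t) :
    HasDerivWithinAt (fun x => Real.arcsin (f x / a))
      (Real.sqrt ((a⁻¹) ^ 2 + (f t) ^ 2)) s t := by
  have hpos : 0 < a ^ 2 - f t ^ 2 := by nlinarith
  have hlt : f t / a < 1 := (div_lt_one ha).2 hup
  have hgt : -1 < f t / a := by rw [lt_div_iff₀ ha]; linarith
  have hsqrt : Real.sqrt (1 - (f t / a) ^ 2) = Real.sqrt (a ^ 2 - f t ^ 2) / a := by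
    rw [show 1 - (f t / a) ^ 2 = (a ^ 2 - f t ^ 2) / a ^ 2 by field_simp,
      Real.sqrt_div hpos.le, Real.sqrt_sq ha.le]
  have hne : Real.sqrt (a ^ 2 - f t ^ 2) ≠ 0 := (Real.sqrt_pos.2 hpos).ne'
  refine ((Real.hasDerivAt_arcsin hgt.ne' hlt.ne).comp_hasDerivWithinAt t
    (hf.div_const a)).congr_deriv ?_
  rw [hsqrt, Real.sqrt_mul hpos.le]
  field_simp

/-- Estimate for solutions of `f' = √((a² - f²)(a⁻² + f²))` with `0 ≤ f < a`:
`arcsin(f(T)/a) ≥ T/a`, hence `T ≤ a π/2`. -/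
theorem stmt_6 (a T : ℝ) (ha0 : 0 < a) (hT : 0 < T)
    (f : ℝ → ℝ)
    (hbound : ∀ t ∈ Icc (0 : ℝ) T, 0 ≤ f t ∧ f t < a)
    (hf0 : f 0 = 0)
    (hderiv : ∀ t ∈ Icc (0 : ℝ) T,
      HasDerivWithinAt f
        (Real.sqrt ((a ^ 2 - (f t) ^ 2) * ((a⁻¹) ^ 2 + (f t) ^ 2))) (Icc 0 T) t) :
    Real.arcsin (f T / a) ≥ T / a ∧ T ≤ a * Real.pi / 2 := by
  have hder : ∀ t ∈ Icc (0 : ℝ) T, HasDerivWithinAt (fun x => Real.arcsin (f x / a))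
      (Real.sqrt ((a⁻¹) ^ 2 + (f t) ^ 2)) (Icc 0 T) t := fun t ht =>
    hasDerivWithinAt_arcsin_div ha0 (by linarith [(hbound t ht).1]) (hbound t ht).2 (hderiv t ht)
  have hder' : ∀ t ∈ interior (Icc (0 : ℝ) T), HasDerivAt (fun x => Real.arcsin (f x / a))
      (Real.sqrt ((a⁻¹) ^ 2 + (f t) ^ 2)) t := fun t ht =>
    (hder t (interior_subset ht)).hasDerivAt (mem_interior_iff_mem_nhds.1 ht)
  have key := (convex_Icc (0 : ℝ) T).mul_sub_le_image_sub_of_le_deriv (C := a⁻¹)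
    (fun t ht => (hder t ht).continuousWithinAt)
    (fun t ht => (hder' t ht).differentiableAt.differentiableWithinAt)
    (fun t ht => by
      rw [(hder' t ht).deriv]
      exact Real.le_sqrt_of_sq_le (le_add_of_nonneg_right (sq_nonneg _)))
    0 (left_mem_Icc.2 hT.le) T (right_mem_Icc.2 hT.le) hT.le
  have hmain : T / a ≤ Real.arcsin (f T / a) := by
    simpa [hf0, div_eq_inv_mul] using key
  refine ⟨hmain, ?_⟩
  have h := (div_le_iff₀ ha0).1 (hmain.trans (Real.arcsin_le_pi_div_two _))
  linarith
end

section
/- For every real number A < −2 there exist t₀ > 0 and a real analytic function f : ℝ → ℝ such that f(0) = 0, f'(0) = 1, (f'(t))² = 1 + A·f(t)² + f(t)⁴ for all t ∈ ℝ, f(t) > 0 for all t ∈ (0, 2t₀), f(2t₀) = 0, and f'(2t₀) = −1. -/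
open Set

open scoped Topology

/-- A real function whose derivative is, near `x`, the real part of a function that is complex
analytic at `x`, is real analytic at `x`. -/
theorem analyticAt_of_hasDerivAt_re {G : ℝ → ℝ} {F : ℂ → ℂ} {x : ℝ} (hF : AnalyticAt ℂ F x)
    (hG : ∀ t : ℝ, HasDerivAt G (F t).re t) : AnalyticAt ℝ G x := by
  obtain ⟨r, hr, hball⟩ := Metric.eventually_nhds_iff_ball.1 hF.eventually_analyticAt
  have hFd : DifferentiableOn ℂ F (Metric.ball (x : ℂ) r) := fun z hz =>
    (hball z hz).differentiableAt.differentiableWithinAt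
  obtain ⟨P, hP⟩ := hFd.isExactOn_ball
  have hPan : AnalyticAt ℂ P x :=
    DifferentiableOn.analyticAt (s := Metric.ball (x : ℂ) r)
      (fun z hz => (hP z hz).differentiableAt.differentiableWithinAt)
      (Metric.ball_mem_nhds _ hr)
  have hsub : ∀ t ∈ Metric.ball x r, HasDerivAt (fun s : ℝ => G s - (P s).re) 0 t := by
    intro t ht
    have hmem : (t : ℂ) ∈ Metric.ball (x : ℂ) r := by
      simpa [Complex.dist_of_im_eq, Real.dist_eq] using ht
    simpa using (hG t).fun_sub (hP t hmem).real_of_complex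
  have hconst : ∀ t ∈ Metric.ball x r, G t - (P t).re = G x - (P x).re := fun t ht =>
    Metric.isOpen_ball.is_const_of_deriv_eq_zero (convex_ball x r).isPreconnected
      (fun s hs => (hsub s hs).differentiableAt.differentiableWithinAt)
      (fun s hs => (hsub s hs).deriv) ht (Metric.mem_ball_self hr)
  have hcongr : (fun t : ℝ => (P t).re + (G x - (P x).re)) =ᶠ[𝓝 x] G := by
    filter_upwards [Metric.ball_mem_nhds x hr] with t ht
    rw [← hconst t ht]
    ring
  exact (hPan.re_ofReal.add analyticAt_const).congr hcongr

/-- A real analytic function on the line with derivative bounded below by a positive constant has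
a global real analytic inverse. -/
theorem exists_analytic_inverse {G k : ℝ → ℝ} {c : ℝ} (hc : 0 < c)
    (hGan : ∀ x, AnalyticAt ℝ G x) (hG : ∀ x, HasDerivAt G (k x) x) (hk : ∀ x, c ≤ k x) :
    ∃ φ : ℝ → ℝ, (∀ t, AnalyticAt ℝ φ t) ∧ StrictMono φ ∧ (∀ x, φ (G x) = x) ∧
      ∀ t, HasDerivAt φ (k (φ t))⁻¹ t := by
  have hkpos : ∀ x, 0 < k x := fun x => hc.trans_le (hk x)
  have hmono : StrictMono G := strictMono_of_deriv_pos fun x => by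
    rw [(hG x).deriv]
    exact hkpos x
  have hlin : Monotone fun x => G x - c * x := by
    have hd : ∀ x, HasDerivAt (fun x => G x - c * x) (k x - c) x := fun x => by
      simpa using (hG x).fun_sub ((hasDerivAt_id x).const_mul c)
    refine monotone_of_deriv_nonneg (fun x => (hd x).differentiableAt) fun x => ?_
    rw [(hd x).deriv]
    exact sub_nonneg.2 (hk x)
  have hcont : Continuous G := continuous_iff_continuousAt.2 fun x => (hG x).continuousAt
  have hsurj : Function.Surjective G := by
    refine hcont.surjective ?_ ?_
    · refine Filter.tendsto_atTop_mono' _ ?_ (Filter.tendsto_atTop_add_const_right _ (G 0)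
        (Filter.tendsto_id.const_mul_atTop hc))
      filter_upwards [Filter.eventually_ge_atTop 0] with x hx
      have := hlin hx
      simp only [id] at *
      linarith
    · refine Filter.tendsto_atBot_mono' _ ?_ (Filter.tendsto_atBot_add_const_right _ (G 0)
        (Filter.tendsto_id.const_mul_atBot hc))
      filter_upwards [Filter.eventually_le_atBot 0] with x hx
      have := hlin hx
      simp only [id] at *
      linarith
  let e : ℝ ≃o ℝ := hmono.orderIsoOfSurjective G hsurj
  have hleft : ∀ x, e.symm (G x) = x := e.symm_apply_apply
  have hright : ∀ t, G (e.symm t) = t := e.apply_symm_apply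
  refine ⟨e.symm, fun t => ?_, e.symm.strictMono, hleft, fun t => ?_⟩
  · have hne : deriv G (e.symm t) ≠ 0 := by
      rw [(hG _).deriv]
      exact (hkpos _).ne'
    have h := (analyticAt_comp_iff_of_deriv_ne_zero (g := e.symm) (hGan (e.symm t)) hne).1 (by
      rw [show (e.symm ∘ G : ℝ → ℝ) = id from funext hleft]
      exact analyticAt_id)
    rwa [hright] at h
  · exact (hG (e.symm t)).of_local_left_inverse e.symm.continuous.continuousAt (hkpos _).ne'
      (Filter.Eventually.of_forall hright)

theorem inv_sub_mul_sin_sq_pos {b : ℝ} (hb0 : 0 < b) (hb1 : b < 1) (x : ℝ) :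
    0 < b⁻¹ - b * Real.sin x ^ 2 := by
  have h1 : 1 < b⁻¹ := (one_lt_inv₀ hb0).2 hb1
  nlinarith [Real.sin_sq_le_one x, sq_nonneg (Real.sin x)]

/-- For `0 < b < 1` the equation `φ' = √(b⁻¹ - b sin² φ)`, `φ 0 = 0`, has a global real analytic
increasing solution, and it attains the value `π`. -/
theorem exists_analytic_amplitude {b : ℝ} (hb0 : 0 < b) (hb1 : b < 1) :
    ∃ (φ : ℝ → ℝ) (T : ℝ), (∀ t, AnalyticAt ℝ φ t) ∧ StrictMono φ ∧ φ 0 = 0 ∧ φ T = Real.pi ∧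
      ∀ t, HasDerivAt φ √(b⁻¹ - b * Real.sin (φ t) ^ 2) t := by
  have hpos : ∀ x, 0 < b⁻¹ - b * Real.sin x ^ 2 := inv_sub_mul_sin_sq_pos hb0 hb1
  let k : ℝ → ℝ := fun x => (√(b⁻¹ - b * Real.sin x ^ 2))⁻¹
  have hk : Continuous k := by
    refine Continuous.inv₀ (by fun_prop) fun x => (Real.sqrt_pos.2 (hpos x)).ne'
  let G : ℝ → ℝ := fun x => ∫ s in (0 : ℝ)..x, k s
  have hG : ∀ x, HasDerivAt G (k x) x := fun x => hk.integral_hasStrictDerivAt 0 x |>.hasDerivAt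
  let F : ℂ → ℂ := fun z => (((b : ℂ)⁻¹ - b * Complex.sin z ^ 2) ^ (1 / 2 : ℂ))⁻¹
  have hbase : ∀ x : ℝ, ((b : ℂ)⁻¹ - b * Complex.sin x ^ 2) =
      ((b⁻¹ - b * Real.sin x ^ 2 : ℝ) : ℂ) := fun x => by push_cast; rfl
  have hFk : ∀ x : ℝ, (F x).re = k x := fun x => by
    simp only [F, k]
    rw [hbase, show (1 / 2 : ℂ) = ((1 / 2 : ℝ) : ℂ) by push_cast; rfl,
      ← Complex.ofReal_cpow (hpos x).le, ← Complex.ofReal_inv, Complex.ofReal_re,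
      Real.sqrt_eq_rpow]
  have hFan : ∀ x : ℝ, AnalyticAt ℂ F x := fun x => by
    have hslit : ((b : ℂ)⁻¹ - b * Complex.sin x ^ 2) ∈ Complex.slitPlane := by
      rw [hbase]
      exact Complex.ofReal_mem_slitPlane.2 (hpos x)
    have hsin : AnalyticAt ℂ Complex.sin x := Complex.analyticAt_sin
    refine AnalyticAt.inv (AnalyticAt.cpow (by fun_prop) analyticAt_const hslit) ?_
    rw [Ne, Complex.cpow_eq_zero_iff]
    exact fun h => Complex.slitPlane_ne_zero hslit h.1
  have hGan : ∀ x, AnalyticAt ℝ G x := fun x =>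
    analyticAt_of_hasDerivAt_re (hFan x) fun t => by
      rw [hFk]
      exact hG t
  have hkge : ∀ x, (√b⁻¹)⁻¹ ≤ k x := fun x =>
    inv_anti₀ (Real.sqrt_pos.2 (hpos x)) (Real.sqrt_le_sqrt (by
      have := mul_nonneg hb0.le (sq_nonneg (Real.sin x))
      linarith))
  obtain ⟨φ, hφan, hφmono, hφG, hφ⟩ :=
    exists_analytic_inverse (inv_pos.2 (Real.sqrt_pos.2 (inv_pos.2 hb0))) hGan hG hkge
  refine ⟨φ, G Real.pi, hφan, hφmono, ?_, hφG _, fun t => ?_⟩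
  · have h := hφG 0
    rwa [show G 0 = 0 from intervalIntegral.integral_same] at h
  · simpa only [k, inv_inv] using hφ t

/-- ODE core of Theorem 3, equation (2.6): for `A < -2` there is a global real
analytic solution of `(f')² = 1 + A f² + f⁴` with `f(0) = 0`, `f'(0) = 1`,
positive on `(0, 2t₀)`, and `f(2t₀) = 0`, `f'(2t₀) = -1`. -/
theorem stmt_12 (A : ℝ) (hA : A < -2) :
    ∃ t₀ : ℝ, 0 < t₀ ∧ ∃ f : ℝ → ℝ,
      (∀ t : ℝ, AnalyticAt ℝ f t) ∧
      f 0 = 0 ∧ deriv f 0 = 1 ∧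
      (∀ t : ℝ, (deriv f t) ^ 2 = 1 + A * (f t) ^ 2 + (f t) ^ 4) ∧
      (∀ t ∈ Ioo (0 : ℝ) (2 * t₀), 0 < f t) ∧
      f (2 * t₀) = 0 ∧ deriv f (2 * t₀) = -1 := by
  obtain ⟨b, hb0, hb1, hbA⟩ : ∃ b : ℝ, 0 < b ∧ b < 1 ∧ A = -(b + b⁻¹) := by
    have hcont : ContinuousOn (fun b : ℝ => b ^ 2 + A * b + 1) (Icc 0 1) := by fun_prop
    obtain ⟨b, hb, hroot⟩ := intermediate_value_Ioo' zero_le_one hcont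
      (show (0 : ℝ) ∈ Ioo _ _ by constructor <;> norm_num; linarith)
    refine ⟨b, hb.1, hb.2, ?_⟩
    have := hb.1.ne'
    field_simp
    linarith
  obtain ⟨φ, T, hφan, hφmono, hφ0, hφT, hφ⟩ := exists_analytic_amplitude hb0 hb1
  have hT : 0 < T := hφmono.lt_iff_lt.1 (by rw [hφ0, hφT]; exact Real.pi_pos)
  have hT2 : 2 * (T / 2) = T := by ring
  have hd : ∀ t, deriv (fun t => √b * Real.sin (φ t)) t =
      √b * (Real.cos (φ t) * √(b⁻¹ - b * Real.sin (φ t) ^ 2)) :=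
    fun t => ((hφ t).sin.const_mul √b).deriv
  have hbb : √b * √b⁻¹ = 1 := by
    rw [← Real.sqrt_mul hb0.le, mul_inv_cancel₀ hb0.ne', Real.sqrt_one]
  refine ⟨T / 2, by positivity, fun t => √b * Real.sin (φ t), fun t => ?_, ?_, ?_, fun t => ?_,
    fun t ht => ?_, ?_, ?_⟩
  · exact analyticAt_const.mul (Real.analyticAt_sin.comp (hφan t))
  · simp [hφ0]
  · simpa [hd, hφ0] using hbb
  · have hs := Real.sq_sqrt hb0.le
    have h4 : √b ^ 4 = b ^ 2 := by linear_combination (√b ^ 2 + b) * hs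
    rw [hd, mul_pow, mul_pow, mul_pow, mul_pow, Real.sq_sqrt (inv_sub_mul_sin_sq_pos hb0 hb1 _).le, hs,
      h4, Real.cos_sq', hbA]
    field_simp
    ring
  · rw [hT2] at ht
    refine mul_pos (Real.sqrt_pos.2 hb0) (Real.sin_pos_of_pos_of_lt_pi ?_ ?_)
    · rw [← hφ0]
      exact hφmono ht.1
    · rw [← hφT]
      exact hφmono ht.2
  · simp [hT2, hφT]
  · rw [hT2, hd, hφT]
    simpa using hbb
end
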